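/- arXiv:0707.3481 — 2 statements merged into one kernel-verified Lean document; each statement's English description precedes it below -/
import Mathlib

section
/- Let k be an algebraically closed field of characteristic zero and let e and n be positive integers. Let G = ZMod e × ZMod (n*e) act trivially on the unit group kˣ (equivalently, consider the trivial ℤ-linear representation of G on Additive kˣ). Then the second group cohomology group H²(G, kˣ) is isomorphic as an abelian group to ZMod e. -/
/-- A `2`-cocycle on an additive group `A` with values in an abelian group `M` carrying the
trivial action. -/
def IsTrivialAddCocycle₂ {A M : Type*} [Add A] [Add M] (f : A → A → M) : Prop :=
  ∀ x y z, f (x + y) z + f x y = f y z + f x (y + z)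

/-- The underlying type of the abelian extension of `A` by `M` attached to a symmetric
`2`-cocycle `f`. -/
@[ext]
structure SymmCocycleExtension {A M : Type*} [AddCommGroup A] [AddCommGroup M] {f : A → A → M}
    (hf : IsTrivialAddCocycle₂ f) (hs : ∀ x y, f x y = f y x) where
  /-- The component in the kernel. -/
  ker : M
  /-- The component in the quotient. -/
  quot : A

namespace IsTrivialAddCocycle₂

variable {A M : Type*} [AddCommGroup A] [AddCommGroup M] {f g : A → A → M}

theorem sub (hf : IsTrivialAddCocycle₂ f) (hg : IsTrivialAddCocycle₂ g) :
    IsTrivialAddCocycle₂ (fun x y => f x y - g x y) := fun x y z => by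
  rw [sub_add_sub_comm, hf, hg, sub_add_sub_comm]

theorem apply_zero_left (hf : IsTrivialAddCocycle₂ f) (x : A) : f 0 x = f 0 0 := by
  simpa using (hf 0 0 x).symm

theorem commutator_add_left (hf : IsTrivialAddCocycle₂ f) (x y z : A) :
    f (x + y) z - f z (x + y) = f x z - f z x + (f y z - f z y) := by
  have h₁ := hf x y z
  have h₂ := hf z x y
  have h₃ := hf x z y
  rw [add_comm z x] at h₂
  rw [add_comm z y] at h₃
  linear_combination (norm := abel) h₁ + h₂ - h₃

/-- The alternating bilinear form `(x, y) ↦ f x y - f y x` attached to a `2`-cocycle `f`. -/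
def commutator (hf : IsTrivialAddCocycle₂ f) : A →+ A →+ M :=
  AddMonoidHom.mk' (fun x => AddMonoidHom.mk' (fun y => f x y - f y x) fun y z => by
      have := hf.commutator_add_left y z x
      rw [← neg_sub, this]
      abel)
    fun x y => AddMonoidHom.ext fun z => hf.commutator_add_left x y z

@[simp]
theorem commutator_apply (hf : IsTrivialAddCocycle₂ f) (x y : A) :
    hf.commutator x y = f x y - f y x := rfl

theorem symm_of_generators {m n : ℕ} {f : ZMod m × ZMod n → ZMod m × ZMod n → M}
    (hf : IsTrivialAddCocycle₂ f) (h : f (1, 0) (0, 1) = f (0, 1) (1, 0))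
    (x y : ZMod m × ZMod n) : f x y = f y x := by
  have key : ∀ x : ZMod m × ZMod n, ∃ i j : ℤ, x = i • (1, 0) + j • (0, 1) := by
    rintro ⟨a, b⟩
    obtain ⟨i, rfl⟩ := ZMod.intCast_surjective a
    obtain ⟨j, rfl⟩ := ZMod.intCast_surjective b
    exact ⟨i, j, by simp⟩
  rw [← sub_eq_zero, ← hf.commutator_apply]
  obtain ⟨i, j, rfl⟩ := key x
  obtain ⟨i', j', rfl⟩ := key y
  simp only [map_add, map_zsmul, AddMonoidHom.add_apply, AddMonoidHom.zsmul_apply,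
    commutator_apply, h, sub_self, smul_zero, add_zero]

end IsTrivialAddCocycle₂

namespace SymmCocycleExtension

variable {A M : Type*} [AddCommGroup A] [AddCommGroup M] {f : A → A → M}
  {hf : IsTrivialAddCocycle₂ f} {hs : ∀ x y, f x y = f y x}

instance : Add (SymmCocycleExtension hf hs) :=
  ⟨fun u v => ⟨u.ker + v.ker + f u.quot v.quot, u.quot + v.quot⟩⟩

instance : Zero (SymmCocycleExtension hf hs) := ⟨⟨-f 0 0, 0⟩⟩

instance : Neg (SymmCocycleExtension hf hs) :=
  ⟨fun u => ⟨-u.ker - f u.quot (-u.quot) - f 0 0, -u.quot⟩⟩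

instance : AddCommGroup (SymmCocycleExtension hf hs) where
  nsmul := nsmulRec
  zsmul := zsmulRec
  add_assoc u v w := by
    refine SymmCocycleExtension.ext ?_ (add_assoc u.quot v.quot w.quot)
    change u.ker + v.ker + f u.quot v.quot + w.ker + f (u.quot + v.quot) w.quot =
      u.ker + (v.ker + w.ker + f v.quot w.quot) + f u.quot (v.quot + w.quot)
    linear_combination (norm := abel) hf u.quot v.quot w.quot
  zero_add u := by
    refine SymmCocycleExtension.ext ?_ (zero_add u.quot)
    change -f 0 0 + u.ker + f 0 u.quot = u.ker
    rw [hf.apply_zero_left u.quot]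
    abel
  add_zero u := by
    refine SymmCocycleExtension.ext ?_ (add_zero u.quot)
    change u.ker + -f 0 0 + f u.quot 0 = u.ker
    rw [hs u.quot, hf.apply_zero_left u.quot]
    abel
  neg_add_cancel u := by
    refine SymmCocycleExtension.ext ?_ (neg_add_cancel u.quot)
    change -u.ker - f u.quot (-u.quot) - f 0 0 + u.ker + f (-u.quot) u.quot = -f 0 0
    rw [hs u.quot]
    abel
  add_comm u v := by
    refine SymmCocycleExtension.ext ?_ (add_comm u.quot v.quot)
    change u.ker + v.ker + f u.quot v.quot = v.ker + u.ker + f v.quot u.quot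
    rw [hs, add_comm u.ker]

theorem mk_add_mk (a b : M) (x y : A) :
    (⟨a, x⟩ + ⟨b, y⟩ : SymmCocycleExtension hf hs) = ⟨a + b + f x y, x + y⟩ := rfl

variable (hf hs) in
/-- The inclusion of the kernel in the extension attached to a symmetric `2`-cocycle. -/
def inclusion : M →+ SymmCocycleExtension hf hs :=
  AddMonoidHom.mk' (fun a => ⟨a - f 0 0, 0⟩) fun a b => by
    rw [mk_add_mk, add_zero]
    congr 1
    abel

theorem inclusion_apply (a : M) : inclusion hf hs a = ⟨a - f 0 0, 0⟩ := rfl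

theorem inclusion_injective : Function.Injective (inclusion hf hs) := fun a b h => by
  simpa [inclusion_apply] using h

end SymmCocycleExtension

/-- A symmetric `2`-cocycle with values in a divisible group is a coboundary. -/
theorem IsTrivialAddCocycle₂.exists_eq_coboundary {A M : Type*} [AddCommGroup A] [AddCommGroup M]
    [DivisibleBy M ℤ] {f : A → A → M} (hf : IsTrivialAddCocycle₂ f)
    (hs : ∀ x y, f x y = f y x) : ∃ c : A → M, ∀ x y, c y - c (x + y) + c x = f x y := by
  obtain ⟨r, hr⟩ := (Module.Baer.of_divisible M).extension_property_addMonoidHom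
    (SymmCocycleExtension.inclusion hf hs) SymmCocycleExtension.inclusion_injective (.id M)
  refine ⟨fun x => r ⟨0, x⟩, fun x y => ?_⟩
  have h : (⟨0, x⟩ + ⟨0, y⟩ : SymmCocycleExtension hf hs) =
      SymmCocycleExtension.inclusion hf hs (f x y) + ⟨0, x + y⟩ := by
    rw [SymmCocycleExtension.inclusion_apply, SymmCocycleExtension.mk_add_mk,
      SymmCocycleExtension.mk_add_mk, hf.apply_zero_left (x + y)]
    simp
  have h' := congrArg r h
  have h'' : r (SymmCocycleExtension.inclusion hf hs (f x y)) = f x y :=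
    DFunLike.congr_fun hr (f x y)
  rw [map_add, map_add, h''] at h'
  linear_combination (norm := abel) h'

/-- The bilinear `2`-cocycle `((a, b), (a', b')) ↦ φ (c * a * b')` on `ZMod e × ZMod (n * e)`. -/
def zmodBilinCocycle {M : Type*} [AddCommGroup M] (e n : ℕ) (φ : ZMod e →+ M) (c : ZMod e)
    (x y : ZMod e × ZMod (n * e)) : M :=
  φ (c * x.1 * ZMod.castHom (Dvd.intro_left n rfl) (ZMod e) y.2)

theorem isTrivialAddCocycle₂_zmodBilinCocycle {M : Type*} [AddCommGroup M] (e n : ℕ)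
    (φ : ZMod e →+ M) (c : ZMod e) : IsTrivialAddCocycle₂ (zmodBilinCocycle e n φ c) :=
  fun x y z => by
    simp only [zmodBilinCocycle, Prod.fst_add, Prod.snd_add, map_add, mul_add, add_mul]
    abel

open groupCohomology

section TrivialCoefficients

variable {A M : Type} [AddCommGroup A] [AddCommGroup M]

theorem mem_cocycles₂_trivial_iff (f : Multiplicative A × Multiplicative A → M) :
    f ∈ cocycles₂ (Rep.trivial ℤ (Multiplicative A) M) ↔
      IsTrivialAddCocycle₂ (fun x y : A => f (.ofAdd x, .ofAdd y)) :=
  mem_cocycles₂_iff (A := Rep.trivial ℤ (Multiplicative A) M) f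

theorem mem_coboundaries₂_trivial_iff (f : Multiplicative A × Multiplicative A → M) :
    f ∈ coboundaries₂ (Rep.trivial ℤ (Multiplicative A) M) ↔
      ∃ c : A → M, ∀ x y : A, c y - c (x + y) + c x = f (.ofAdd x, .ofAdd y) := by
  constructor
  · rintro ⟨c, rfl⟩
    exact ⟨c, fun _ _ => rfl⟩
  · rintro ⟨c, hc⟩
    exact ⟨c, funext fun p => hc p.1 p.2⟩

end TrivialCoefficients

section ZModProd

variable {M : Type} [AddCommGroup M] (e n : ℕ) (φ : ZMod e →+ M)

/-- The homomorphism sending `c` to the class of the bilinear cocycle with parameter `c`. -/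
noncomputable def zmodToH2 :
    ZMod e →+ H2 (Rep.trivial ℤ (Multiplicative (ZMod e × ZMod (n * e))) M) :=
  (H2π (Rep.trivial ℤ (Multiplicative (ZMod e × ZMod (n * e))) M)).hom.toAddMonoidHom.comp
    (AddMonoidHom.mk' (fun c => ⟨fun p => zmodBilinCocycle e n φ c p.1.toAdd p.2.toAdd,
        (mem_cocycles₂_trivial_iff _).2 (isTrivialAddCocycle₂_zmodBilinCocycle e n φ c)⟩)
      fun c d => Subtype.ext <| funext fun p => by
        change φ _ = φ _ + φ _
        rw [← map_add, add_mul, add_mul])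

theorem zmodToH2_injective (hφ : Function.Injective φ) :
    Function.Injective (zmodToH2 e n φ) := by
  rw [injective_iff_map_eq_zero]
  intro c hc
  obtain ⟨u, hu⟩ := (mem_coboundaries₂_trivial_iff _).1 ((H2π_eq_zero_iff _).1 hc)
  have h₁ : _ = φ _ := hu (1, 0) (0, 1)
  have h₂ : _ = φ _ := hu (0, 1) (1, 0)
  have h : φ c = φ 0 := by
    have h₁' : φ c = u (0, 1) - u ((1, 0) + (0, 1)) + u (1, 0) := by
      simpa using h₁.symm
    have h₂' : φ 0 = u (1, 0) - u ((0, 1) + (1, 0)) + u (0, 1) := by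
      simpa using h₂.symm
    rw [h₁', h₂', add_comm (0, 1)]
    abel
  exact hφ h

theorem zmodToH2_surjective [DivisibleBy M ℤ] (hφ : ∀ m : M, e • m = 0 → m ∈ Set.range φ) :
    Function.Surjective (zmodToH2 e n φ) := by
  intro y
  induction y using H2_induction_on with
  | h f =>
    have hf := (mem_cocycles₂_trivial_iff _).1 f.2
    obtain ⟨c, hc⟩ := hφ (hf.commutator (1, 0) (0, 1)) (by
      rw [← AddMonoidHom.nsmul_apply, ← map_nsmul]
      simp [Prod.mk_zero_zero])
    refine ⟨c, (H2π_eq_iff _ _).2 ((mem_coboundaries₂_trivial_iff _).2 ?_)⟩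
    have hd := (isTrivialAddCocycle₂_zmodBilinCocycle e n φ c).sub hf
    refine hd.exists_eq_coboundary (hd.symm_of_generators ?_)
    simp only [zmodBilinCocycle, mul_one, mul_zero, map_one, map_zero, hc,
      hf.commutator_apply]
    abel

end ZModProd

theorem nonempty_divisibleBy_additive_units (k : Type*) [Field k] [IsAlgClosed k] :
    Nonempty (DivisibleBy (Additive kˣ) ℤ) :=
  let _ : DivisibleBy (Additive kˣ) ℕ := divisibleByOfSMulRightSurj _ _ fun {n} hn a => by
    obtain ⟨z, hz⟩ := IsAlgClosed.exists_pow_nat_eq (a.toMul : k) (Nat.pos_of_ne_zero hn)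
    have hz0 : z ≠ 0 := by
      rintro rfl
      rw [zero_pow hn] at hz
      exact a.toMul.ne_zero hz.symm
    exact ⟨.ofMul (Units.mk0 z hz0), Additive.toMul.injective (Units.ext hz)⟩
  ⟨AddGroup.divisibleByIntOfDivisibleByNat _⟩

/-- **McKay correspondence for canonical orders, Section 3**:
for `G = ℤ/e × ℤ/ne` acting trivially on `kˣ` (`k` algebraically closed of
characteristic zero), one has `H²(G, kˣ) ≅ ℤ/e` as abelian groups. -/
theorem stmt_0 (k : Type) [Field k] [IsAlgClosed k] [CharZero k]
    (e n : ℕ) (he : 0 < e) (hn : 0 < n) :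
    Nonempty
      ((groupCohomology
          (Rep.trivial ℤ (Multiplicative (ZMod e × ZMod (n * e))) (Additive kˣ)) 2) ≃+
        ZMod e) := by
  obtain ⟨_⟩ := nonempty_divisibleBy_additive_units k
  have : NeZero e := ⟨he.ne'⟩
  have : NeZero (e : k) := ⟨Nat.cast_ne_zero.2 he.ne'⟩
  obtain ⟨ζ', hζ'⟩ := HasEnoughRootsOfUnity.exists_primitiveRoot k e
  obtain ⟨ζ, rfl⟩ := hζ'.isUnit he.ne'
  have hζ : IsPrimitiveRoot ζ e := IsPrimitiveRoot.coe_units_iff.1 hζ'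
  let φ : ZMod e →+ Additive kˣ :=
    (Subgroup.zpowers ζ).subtype.toAdditive.comp hζ.zmodEquivZPowers.toAddMonoidHom
  have hinj : Function.Injective φ :=
    Subtype.val_injective.comp hζ.zmodEquivZPowers.injective
  have hrange : ∀ m : Additive kˣ, e • m = 0 → m ∈ Set.range φ := fun m hm => by
    have hmem : m.toMul ∈ Subgroup.zpowers ζ := by
      rw [hζ.zpowers_eq]
      exact (mem_rootsOfUnity _ _).2 hm
    obtain ⟨c, hc⟩ := hζ.zmodEquivZPowers.surjective (.ofMul ⟨m.toMul, hmem⟩)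
    exact ⟨c, congrArg Subtype.val hc⟩
  exact ⟨(AddEquiv.ofBijective (zmodToH2 e n φ)
    ⟨zmodToH2_injective e n φ hinj, zmodToH2_surjective e n φ hrange⟩).symm⟩
end

section
/- Let e and n be positive integers and let G' be the group given by the presentation with generators σ, τ, ρ and relations σ^e = 1, τ^{n·e} = 1, ρ^e = 1, σ τ σ⁻¹ τ⁻¹ = ρ, σ ρ = ρ σ, τ ρ = ρ τ (Mathlib's PresentedGroup on three generators with these relators). Then: (1) the image of ρ in G' generates a subgroup C contained in the center of G' and C has order e; (2) the quotient G' ⧸ C is isomorphic as a group to Multiplicative (ZMod e × ZMod (n*e)); and (3) G' has cardinality n · e³. -/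
open FreeGroup in
/-- The relators `σ^e, τ^{ne}, ρ^e, στσ⁻¹τ⁻¹ρ⁻¹, σρσ⁻¹ρ⁻¹, τρτ⁻¹ρ⁻¹` of the group
`G' = ⟨σ, τ, ρ | σ^e = τ^{ne} = ρ^e = 1, στ = ρτσ, ρσ = σρ, ρτ = τρ⟩` of
Example 3.2 of the paper, where `σ, τ, ρ` are the generators `0, 1, 2`. -/
def canonicalRels (e n : ℕ) : Set (FreeGroup (Fin 3)) :=
  {of 0 ^ e, of 1 ^ (n * e), of 2 ^ e,
    of 0 * of 1 * (of 0)⁻¹ * (of 1)⁻¹ * (of 2)⁻¹,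
    of 0 * of 2 * (of 0)⁻¹ * (of 2)⁻¹,
    of 1 * of 2 * (of 1)⁻¹ * (of 2)⁻¹}

/-- The Heisenberg-type group of triples `(a, b, c)`, standing for `ρ ^ c * τ ^ b * σ ^ a`. -/
@[ext]
structure HeisenbergTriple (e n : ℕ) where
  /-- The exponent of `σ`. -/
  a : ZMod e
  /-- The exponent of `τ`. -/
  b : ZMod (n * e)
  /-- The exponent of `ρ`. -/
  c : ZMod e

namespace HeisenbergTriple

variable {e n : ℕ}

/-- Reduction of the exponent of `τ` modulo `e`. -/
def red (e n : ℕ) : ZMod (n * e) →+* ZMod e := ZMod.castHom (Dvd.intro_left n rfl) (ZMod e)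

instance : Mul (HeisenbergTriple e n) :=
  ⟨fun x y => ⟨x.a + y.a, x.b + y.b, x.c + y.c + x.a * red e n y.b⟩⟩

instance : One (HeisenbergTriple e n) := ⟨⟨0, 0, 0⟩⟩

instance : Inv (HeisenbergTriple e n) :=
  ⟨fun x => ⟨-x.a, -x.b, -x.c + x.a * red e n x.b⟩⟩

@[simp] lemma mul_a (x y : HeisenbergTriple e n) : (x * y).a = x.a + y.a := rfl
@[simp] lemma mul_b (x y : HeisenbergTriple e n) : (x * y).b = x.b + y.b := rfl
@[simp] lemma mul_c (x y : HeisenbergTriple e n) :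
    (x * y).c = x.c + y.c + x.a * red e n y.b := rfl
@[simp] lemma one_a : (1 : HeisenbergTriple e n).a = 0 := rfl
@[simp] lemma one_b : (1 : HeisenbergTriple e n).b = 0 := rfl
@[simp] lemma one_c : (1 : HeisenbergTriple e n).c = 0 := rfl
@[simp] lemma inv_a (x : HeisenbergTriple e n) : x⁻¹.a = -x.a := rfl
@[simp] lemma inv_b (x : HeisenbergTriple e n) : x⁻¹.b = -x.b := rfl
@[simp] lemma inv_c (x : HeisenbergTriple e n) : x⁻¹.c = -x.c + x.a * red e n x.b := rfl

instance : Group (HeisenbergTriple e n) :=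
  Group.ofLeftAxioms
    (fun x y z => by ext <;> simp <;> ring)
    (fun x => by ext <;> simp)
    (fun x => by ext <;> simp)

/-- The underlying triple, as an element of a product type. -/
def equivProd (e n : ℕ) : HeisenbergTriple e n ≃ ZMod e × ZMod (n * e) × ZMod e where
  toFun x := (x.a, x.b, x.c)
  invFun p := ⟨p.1, p.2.1, p.2.2⟩

lemma card_eq (e n : ℕ) : Nat.card (HeisenbergTriple e n) = n * e ^ 3 := by
  rw [Nat.card_congr (equivProd e n), Nat.card_prod, Nat.card_prod, Nat.card_zmod, Nat.card_zmod]
  ring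

/-- The inclusion of the cyclic subgroup generated by `σ`. -/
def sigmaHom (e n : ℕ) : Multiplicative (ZMod e) →* HeisenbergTriple e n where
  toFun x := ⟨x.toAdd, 0, 0⟩
  map_one' := rfl
  map_mul' x y := by ext <;> simp

/-- The inclusion of the cyclic subgroup generated by `τ`. -/
def tauHom (e n : ℕ) : Multiplicative (ZMod (n * e)) →* HeisenbergTriple e n where
  toFun x := ⟨0, x.toAdd, 0⟩
  map_one' := rfl
  map_mul' x y := by ext <;> simp

/-- The inclusion of the cyclic subgroup generated by `ρ`. -/
def rhoHom (e n : ℕ) : Multiplicative (ZMod e) →* HeisenbergTriple e n where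
  toFun x := ⟨0, 0, x.toAdd⟩
  map_one' := rfl
  map_mul' x y := by ext <;> simp

lemma sigma_zpow (k : ℤ) : (⟨1, 0, 0⟩ : HeisenbergTriple e n) ^ k = ⟨k, 0, 0⟩ := by
  simpa [sigmaHom] using (map_zpow (sigmaHom e n) (Multiplicative.ofAdd 1) k).symm

lemma tau_zpow (k : ℤ) : (⟨0, 1, 0⟩ : HeisenbergTriple e n) ^ k = ⟨0, k, 0⟩ := by
  simpa [tauHom] using (map_zpow (tauHom e n) (Multiplicative.ofAdd 1) k).symm

lemma rho_zpow (k : ℤ) : (⟨0, 0, 1⟩ : HeisenbergTriple e n) ^ k = ⟨0, 0, k⟩ := by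
  simpa [rhoHom] using (map_zpow (rhoHom e n) (Multiplicative.ofAdd 1) k).symm

lemma rho_tau_sigma_zpow (a b c : ℤ) :
    (⟨0, 0, 1⟩ : HeisenbergTriple e n) ^ c * ⟨0, 1, 0⟩ ^ b * ⟨1, 0, 0⟩ ^ a = ⟨a, b, c⟩ := by
  rw [rho_zpow, tau_zpow, sigma_zpow]
  ext <;> simp

/-- The projection that forgets the central coordinate. -/
def proj (e n : ℕ) : HeisenbergTriple e n →* Multiplicative (ZMod e × ZMod (n * e)) where
  toFun x := Multiplicative.ofAdd (x.a, x.b)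
  map_one' := rfl
  map_mul' _ _ := rfl

end HeisenbergTriple

section NormalForm

variable {G : Type*} [Group G] {s t r : G}

lemma zpow_mul_zpow_of_central_commutator (hst : s * t = r * t * s) (hsr : Commute s r)
    (htr : Commute t r) (a b : ℤ) : s ^ a * t ^ b = r ^ (a * b) * t ^ b * s ^ a := by
  have h1 : SemiconjBy s t (r * t) := hst
  have h2 : s * t ^ b = r ^ b * t ^ b * s := by
    have h := h1.zpow_right b
    rwa [htr.symm.mul_zpow] at h
  have h3 : SemiconjBy (t ^ b) (r ^ b * s) s := by
    have hc : Commute (t ^ b) (r ^ b) := htr.zpow_zpow b b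
    rw [SemiconjBy, h2, ← mul_assoc, hc.eq]
  have h4 := h3.zpow_right a
  rw [(hsr.symm.zpow_left b).mul_zpow, ← zpow_mul, mul_comm b a] at h4
  rw [← h4.eq, ← mul_assoc, (htr.zpow_zpow b (a * b)).eq]

lemma exists_zpow_mul_zpow_mul_zpow_of_mem_closure (hst : s * t = r * t * s) (hsr : Commute s r)
    (htr : Commute t r) {x : G} (hx : x ∈ Subgroup.closure {s, t, r}) :
    ∃ a b c : ℤ, x = r ^ c * t ^ b * s ^ a := by
  induction hx using Subgroup.closure_induction with
  | mem x hx =>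
    rcases hx with rfl | rfl | rfl
    · exact ⟨1, 0, 0, by simp⟩
    · exact ⟨0, 1, 0, by simp⟩
    · exact ⟨0, 0, 1, by simp⟩
  | one => exact ⟨0, 0, 0, by simp⟩
  | mul x y _ _ hx hy =>
    obtain ⟨a, b, c, rfl⟩ := hx
    obtain ⟨a', b', c', rfl⟩ := hy
    refine ⟨a + a', b + b', c + c' + a * b', ?_⟩
    have h := zpow_mul_zpow_of_central_commutator hst hsr htr a b'
    calc r ^ c * t ^ b * s ^ a * (r ^ c' * t ^ b' * s ^ a')
        = r ^ c * t ^ b * (s ^ a * r ^ c') * t ^ b' * s ^ a' := by group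
      _ = r ^ c * (t ^ b * r ^ c') * (s ^ a * t ^ b') * s ^ a' := by
          rw [(hsr.zpow_zpow a c').eq]; simp only [mul_assoc]
      _ = r ^ c * r ^ c' * (t ^ b * r ^ (a * b')) * t ^ b' * s ^ a * s ^ a' := by
          rw [(htr.zpow_zpow b c').eq, h]; simp only [mul_assoc]
      _ = r ^ (c + c' + a * b') * t ^ (b + b') * s ^ (a + a') := by
          rw [(htr.zpow_zpow b (a * b')).eq]; simp only [mul_assoc, zpow_add]
  | inv x _ hx =>
    obtain ⟨a, b, c, rfl⟩ := hx
    refine ⟨-a, -b, a * b - c, ?_⟩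
    have h := zpow_mul_zpow_of_central_commutator hst hsr htr (-a) (-b)
    have hc : Commute (s ^ (-a) * t ^ (-b)) (r ^ (-c)) :=
      (hsr.zpow_zpow _ _).mul_left (htr.zpow_zpow _ _)
    calc (r ^ c * t ^ b * s ^ a)⁻¹ = s ^ (-a) * t ^ (-b) * r ^ (-c) := by
          simp only [mul_inv_rev, zpow_neg, mul_assoc]
      _ = r ^ (-c) * (r ^ (-a * -b) * t ^ (-b) * s ^ (-a)) := by rw [hc.eq, h]
      _ = r ^ (a * b - c) * t ^ (-b) * s ^ (-a) := by
          rw [neg_mul_neg, sub_eq_neg_add, zpow_add]; simp only [mul_assoc]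

end NormalForm

namespace canonicalRels

open PresentedGroup

variable {e n : ℕ}

lemma mk_eq_one {w : FreeGroup (Fin 3)} (hw : w ∈ canonicalRels e n) :
    PresentedGroup.mk (canonicalRels e n) w = 1 :=
  one_of_mem hw

lemma sigma_pow : (of 0 : PresentedGroup (canonicalRels e n)) ^ e = 1 := by
  have h := mk_eq_one (e := e) (n := n) (w := .of 0 ^ e) (by simp [canonicalRels])
  rwa [map_pow] at h

lemma tau_pow : (of 1 : PresentedGroup (canonicalRels e n)) ^ (n * e) = 1 := by
  have h := mk_eq_one (e := e) (n := n) (w := .of 1 ^ (n * e)) (by simp [canonicalRels])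
  rwa [map_pow] at h

lemma rho_pow : (of 2 : PresentedGroup (canonicalRels e n)) ^ e = 1 := by
  have h := mk_eq_one (e := e) (n := n) (w := .of 2 ^ e) (by simp [canonicalRels])
  rwa [map_pow] at h

lemma sigma_mul_tau :
    (of 0 : PresentedGroup (canonicalRels e n)) * of 1 = of 2 * of 1 * of 0 := by
  have h := mk_eq_one (e := e) (n := n)
    (w := .of 0 * .of 1 * (.of 0)⁻¹ * (.of 1)⁻¹ * (.of 2)⁻¹) (by simp [canonicalRels])
  simp only [map_mul, map_inv] at h
  rwa [mul_inv_eq_one, mul_inv_eq_iff_eq_mul, mul_inv_eq_iff_eq_mul] at h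

lemma commute_sigma_rho : Commute (of 0 : PresentedGroup (canonicalRels e n)) (of 2) := by
  have h := mk_eq_one (e := e) (n := n)
    (w := .of 0 * .of 2 * (.of 0)⁻¹ * (.of 2)⁻¹) (by simp [canonicalRels])
  simp only [map_mul, map_inv] at h
  rwa [mul_inv_eq_one, mul_inv_eq_iff_eq_mul] at h

lemma commute_tau_rho : Commute (of 1 : PresentedGroup (canonicalRels e n)) (of 2) := by
  have h := mk_eq_one (e := e) (n := n)
    (w := .of 1 * .of 2 * (.of 1)⁻¹ * (.of 2)⁻¹) (by simp [canonicalRels])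
  simp only [map_mul, map_inv] at h
  rwa [mul_inv_eq_one, mul_inv_eq_iff_eq_mul] at h

lemma exists_eq_zpow (x : PresentedGroup (canonicalRels e n)) :
    ∃ a b c : ℤ, x = of 2 ^ c * of 1 ^ b * of 0 ^ a := by
  refine exists_zpow_mul_zpow_mul_zpow_of_mem_closure sigma_mul_tau commute_sigma_rho
    commute_tau_rho ?_
  have h : x ∈ Subgroup.closure (Set.range (of (rels := canonicalRels e n))) := by
    rw [closure_range_of]
    trivial
  refine Subgroup.closure_mono ?_ h
  rintro _ ⟨i, rfl⟩
  fin_cases i <;> simp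

/-- The images of `σ, τ, ρ` in the group of triples. -/
def genImage (e n : ℕ) : Fin 3 → HeisenbergTriple e n :=
  ![⟨1, 0, 0⟩, ⟨0, 1, 0⟩, ⟨0, 0, 1⟩]

lemma lift_genImage_eq_one (w : FreeGroup (Fin 3)) (hw : w ∈ canonicalRels e n) :
    FreeGroup.lift (genImage e n) w = 1 := by
  rcases hw with rfl | rfl | rfl | rfl | rfl | rfl
  · rw [map_pow, FreeGroup.lift_apply_of, ← zpow_natCast]
    simp only [genImage, Matrix.cons_val, HeisenbergTriple.sigma_zpow]
    ext <;> simp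
  · rw [map_pow, FreeGroup.lift_apply_of, ← zpow_natCast]
    simp only [genImage, Matrix.cons_val, HeisenbergTriple.tau_zpow]
    rw [Int.cast_natCast, ZMod.natCast_self]
    rfl
  · rw [map_pow, FreeGroup.lift_apply_of, ← zpow_natCast]
    simp only [genImage, Matrix.cons_val, HeisenbergTriple.rho_zpow]
    ext <;> simp
  all_goals
    simp only [map_mul, map_inv, FreeGroup.lift_apply_of, genImage, Matrix.cons_val]
    ext <;> simp

/-- The homomorphism from the presented group to the group of triples. -/
def toTriple (e n : ℕ) : PresentedGroup (canonicalRels e n) →* HeisenbergTriple e n :=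
  toGroup lift_genImage_eq_one

lemma toTriple_of (i : Fin 3) : toTriple e n (of i) = genImage e n i :=
  toGroup.of lift_genImage_eq_one

lemma toTriple_zpow (a b c : ℤ) :
    toTriple e n (of 2 ^ c * of 1 ^ b * of 0 ^ a) = ⟨a, b, c⟩ := by
  simp only [map_mul, map_zpow, toTriple_of]
  exact HeisenbergTriple.rho_tau_sigma_zpow a b c

lemma zpow_eq_one_of_intCast_eq_zero {G : Type*} [Group G] {g : G} {m : ℕ} (hg : g ^ m = 1)
    {k : ℤ} (hk : (k : ZMod m) = 0) : g ^ k = 1 := by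
  obtain ⟨l, rfl⟩ := (ZMod.intCast_zmod_eq_zero_iff_dvd k m).1 hk
  rw [zpow_mul, zpow_natCast, hg, one_zpow]

lemma toTriple_bijective : Function.Bijective (toTriple e n) := by
  constructor
  · rw [injective_iff_map_eq_one]
    intro x hx
    obtain ⟨a, b, c, rfl⟩ := exists_eq_zpow x
    rw [toTriple_zpow, HeisenbergTriple.ext_iff] at hx
    obtain ⟨ha, hb, hc⟩ := hx
    rw [zpow_eq_one_of_intCast_eq_zero sigma_pow ha, zpow_eq_one_of_intCast_eq_zero tau_pow hb,
      zpow_eq_one_of_intCast_eq_zero rho_pow hc, one_mul, one_mul]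
  · rintro ⟨a, b, c⟩
    obtain ⟨a, rfl⟩ := ZMod.intCast_surjective a
    obtain ⟨b, rfl⟩ := ZMod.intCast_surjective b
    obtain ⟨c, rfl⟩ := ZMod.intCast_surjective c
    exact ⟨_, toTriple_zpow a b c⟩

lemma orderOf_rho : orderOf (of 2 : PresentedGroup (canonicalRels e n)) = e := by
  refine Nat.dvd_antisymm (orderOf_dvd_of_pow_eq_one rho_pow) ?_
  set k := orderOf (of 2 : PresentedGroup (canonicalRels e n)) with hk
  have h := toTriple_zpow (e := e) (n := n) 0 0 k
  rw [zpow_natCast, hk, pow_orderOf_eq_one, zpow_zero, zpow_zero, one_mul, one_mul, map_one,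
    HeisenbergTriple.ext_iff] at h
  rw [← ZMod.natCast_eq_zero_iff]
  simpa using h.2.2.symm

lemma zpowers_rho_le_center :
    Subgroup.zpowers (of 2 : PresentedGroup (canonicalRels e n)) ≤ Subgroup.center _ := by
  rw [Subgroup.zpowers_le, Subgroup.mem_center_iff]
  intro x
  obtain ⟨a, b, c, rfl⟩ := exists_eq_zpow x
  exact (((Commute.refl _).zpow_left c).mul_left (commute_tau_rho.zpow_left b)).mul_left
    (commute_sigma_rho.zpow_left a)

lemma ker_proj_comp_toTriple :
    ((HeisenbergTriple.proj e n).comp (toTriple e n)).ker = Subgroup.zpowers (of 2) := by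
  ext x
  obtain ⟨a, b, c, rfl⟩ := exists_eq_zpow x
  rw [MonoidHom.mem_ker, MonoidHom.comp_apply]
  constructor
  · intro h
    rw [toTriple_zpow] at h
    have ha : (a : ZMod e) = 0 := congrArg (fun p => p.toAdd.1) h
    have hb : (b : ZMod (n * e)) = 0 := congrArg (fun p => p.toAdd.2) h
    rw [zpow_eq_one_of_intCast_eq_zero sigma_pow ha, zpow_eq_one_of_intCast_eq_zero tau_pow hb,
      mul_one, mul_one]
    exact Subgroup.zpow_mem_zpowers _ c
  · rintro ⟨k, hk⟩
    have h := toTriple_zpow (e := e) (n := n) 0 0 k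
    rw [zpow_zero, zpow_zero, mul_one, mul_one] at h
    rw [← hk]
    dsimp only
    rw [h]
    simp [HeisenbergTriple.proj, ← Prod.zero_eq_mk]

end canonicalRels

/-- **Example 3.2**: for the presented group
`G' = ⟨σ, τ, ρ | σ^e = τ^{ne} = ρ^e = 1, στσ⁻¹τ⁻¹ = ρ, σρ = ρσ, τρ = ρτ⟩`:
(1) the image of `ρ` generates a central subgroup `C` of order `e`;
(2) `G'⧸C ≅ ℤ/e × ℤ/ne` (expressed via a surjection with kernel `C`);
(3) `|G'| = n·e³`. -/
theorem stmt_6 (e n : ℕ) (he : 0 < e) (hn : 0 < n) :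
    Subgroup.zpowers (PresentedGroup.of 2 : PresentedGroup (canonicalRels e n)) ≤
        Subgroup.center (PresentedGroup (canonicalRels e n)) ∧
      Nat.card
          (Subgroup.zpowers (PresentedGroup.of 2 : PresentedGroup (canonicalRels e n))) = e ∧
      (∃ φ : PresentedGroup (canonicalRels e n) →* Multiplicative (ZMod e × ZMod (n * e)),
        Function.Surjective φ ∧
          φ.ker = Subgroup.zpowers (PresentedGroup.of 2 : PresentedGroup (canonicalRels e n))) ∧
      Nat.card (PresentedGroup (canonicalRels e n)) = n * e ^ 3 := by
  refine ⟨canonicalRels.zpowers_rho_le_center, ?_,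
    ⟨(HeisenbergTriple.proj e n).comp (canonicalRels.toTriple e n), ?_,
      canonicalRels.ker_proj_comp_toTriple⟩, ?_⟩
  · rw [Nat.card_zpowers, canonicalRels.orderOf_rho]
  · have h : Function.Surjective (HeisenbergTriple.proj e n) :=
      fun p => ⟨⟨p.toAdd.1, p.toAdd.2, 0⟩, rfl⟩
    exact h.comp canonicalRels.toTriple_bijective.surjective
  · rw [Nat.card_congr (Equiv.ofBijective _ canonicalRels.toTriple_bijective),
      HeisenbergTriple.card_eq]
end
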